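/- Let Γ be a recursive game in which the sequence of n-stage values (v_n)_{n≥1} converges uniformly on X to a function v satisfying v(x) ≥ M' for every x ∈ X⁰, for some constant M' > 0. Then Γ is positive-valued, and player 1 uniformly guarantees v with uniformly terminating strategies. -/

import Mathlib

open scoped Classical
open Filter

noncomputable section

/-- A two-player zero-sum stochastic game: a state space `X`, action sets `A`, `B`
with a nonempty finite feasible subset at every state, a payoff function with values
in `[-1,1]`, and a finitely supported transition probability function. -/
structure StocGame where
  X : Type
  A : Type
  B : Type
  actA : X → Finset A
  actB : X → Finset B
  actA_nonempty : ∀ x, (actA x).Nonempty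
  actB_nonempty : ∀ x, (actB x).Nonempty
  g : X → A → B → ℝ
  g_bdd : ∀ x a b, |g x a b| ≤ 1
  q : X → A → B → X → ℝ
  q_nonneg : ∀ x a b y, 0 ≤ q x a b y
  q_finsupp : ∀ x a b, (Function.support (q x a b)).Finite
  q_sum : ∀ x a b, (∑' y, q x a b y) = 1

namespace StocGame

variable (G : StocGame)

/-- A behavior strategy of player 1: to every past history (a chronological list of
(state, action of player 1, action of player 2) triples) and every current state, it
assigns a mixed action supported on the feasible action set. -/
structure Strategy1 where
  play : List (G.X × G.A × G.B) → G.X → G.A → ℝ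
  nonneg : ∀ h x a, 0 ≤ play h x a
  supp : ∀ h x a, a ∉ G.actA x → play h x a = 0
  sum_one : ∀ h x, ∑ a ∈ G.actA x, play h x a = 1

/-- A behavior strategy of player 2. -/
structure Strategy2 where
  play : List (G.X × G.A × G.B) → G.X → G.B → ℝ
  nonneg : ∀ h x b, 0 ≤ play h x b
  supp : ∀ h x b, b ∉ G.actB x → play h x b = 0
  sum_one : ∀ h x, ∑ b ∈ G.actB x, play h x b = 1

variable {G}

/-- The chronological sequence of states visited along a finite history
(past history together with the current state). -/
def stateSeq (hx : List (G.X × G.A × G.B) × G.X) : List G.X :=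
  hx.1.map Prod.fst ++ [hx.2]

/-- A strategy of player 1 which depends on the history only through the sequence of
visited states (and not on past actions). -/
def Strategy1.stateDep (σ : Strategy1 G) : Prop :=
  ∀ h h' x, h.map Prod.fst = h'.map Prod.fst → σ.play h x = σ.play h' x

/-- A strategy of player 2 which depends on the history only through the sequence of
visited states (and not on past actions). -/
def Strategy2.stateDep (τ : Strategy2 G) : Prop :=
  ∀ h h' x, h.map Prod.fst = h'.map Prod.fst → τ.play h x = τ.play h' x

/-- A pure strategy of player 1. -/
def Strategy1.pure (σ : Strategy1 G) : Prop :=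
  ∀ h x, ∃ a ∈ G.actA x, σ.play h x a = 1

/-- A pure strategy of player 2. -/
def Strategy2.pure (τ : Strategy2 G) : Prop :=
  ∀ h x, ∃ b ∈ G.actB x, τ.play h x b = 1

variable (G)

/-- Auxiliary function: the probability of a finite history, the past history being
given in reverse chronological order. -/
def histProbAux (x₁ : G.X) (σ : Strategy1 G) (τ : Strategy2 G) :
    List (G.X × G.A × G.B) → G.X → ℝ
  | [], x => if x = x₁ then 1 else 0
  | (y, a, b) :: rest, x =>
      histProbAux x₁ σ τ rest y * σ.play rest.reverse y a * τ.play rest.reverse y b *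
        G.q y a b x

/-- Probability, in the game starting at `x₁` played with `(σ, τ)`, that the play starts
with the (chronological) past history `h` followed by the current state `x`. -/
def histProb (x₁ : G.X) (σ : Strategy1 G) (τ : Strategy2 G)
    (h : List (G.X × G.A × G.B)) (x : G.X) : ℝ :=
  G.histProbAux x₁ σ τ h.reverse x

/-- Expected payoff of stage `t` in the game starting at `x₁` played with `(σ, τ)`. -/
def stagePayoff (x₁ : G.X) (σ : Strategy1 G) (τ : Strategy2 G) (t : ℕ) : ℝ :=
  ∑' hx : List (G.X × G.A × G.B) × G.X,
    if hx.1.length + 1 = t then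
      G.histProb x₁ σ τ hx.1 hx.2 *
        ∑ a ∈ G.actA hx.2, ∑ b ∈ G.actB hx.2,
          σ.play hx.1 hx.2 a * τ.play hx.1 hx.2 b * G.g hx.2 a b
    else 0

/-- Expected average payoff `γ_n(x₁, σ, τ)` over the `n` first stages. -/
def avgPayoff (x₁ : G.X) (σ : Strategy1 G) (τ : Strategy2 G) (n : ℕ) : ℝ :=
  (n : ℝ)⁻¹ * ∑ t ∈ Finset.Icc 1 n, G.stagePayoff x₁ σ τ t

/-- Expected `λ`-discounted payoff `γ_λ(x₁, σ, τ)`. -/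
def discPayoff (x₁ : G.X) (σ : Strategy1 G) (τ : Strategy2 G) (lam : ℝ) : ℝ :=
  ∑' t : ℕ, lam * (1 - lam) ^ t * G.stagePayoff x₁ σ τ (t + 1)

/-- The value `v_n(x₁)` of the `n`-stage game (by the minmax theorem, the game has a
value, which is then equal to this maxmin). -/
def nValue (n : ℕ) (x₁ : G.X) : ℝ :=
  ⨆ σ : Strategy1 G, ⨅ τ : Strategy2 G, G.avgPayoff x₁ σ τ n

/-- The value `v_λ(x₁)` of the `λ`-discounted game. -/
def lamValue (lam : ℝ) (x₁ : G.X) : ℝ :=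
  ⨆ σ : Strategy1 G, ⨅ τ : Strategy2 G, G.discPayoff x₁ σ τ lam

/-- The pointwise limit superior `v(x) = limsup_n v_n(x)` of the `n`-stage values. -/
def limsupV (x : G.X) : ℝ := Filter.limsup (fun n => G.nValue n x) Filter.atTop

/-- The family `{v_n, n ≥ 1}` is totally bounded for the uniform norm: for every
`ε > 0` there is a finite subfamily within uniform distance `ε` of every member. -/
def TotallyBoundedValues : Prop :=
  ∀ ε > (0 : ℝ), ∃ S : Finset ℕ, (∀ m ∈ S, 1 ≤ m) ∧
    ∀ n, 1 ≤ n → ∃ m ∈ S, ∀ x, |G.nValue n x - G.nValue m x| ≤ ε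

/-- Probability that the sequence of the first states of the play is `s`. -/
def statesProb (x₁ : G.X) (σ : Strategy1 G) (τ : Strategy2 G) (s : List G.X) : ℝ :=
  ∑' hx : List (G.X × G.A × G.B) × G.X,
    if stateSeq hx = s then G.histProb x₁ σ τ hx.1 hx.2 else 0

end StocGame

/-- A two-player zero-sum recursive game: a stochastic game whose state space is
partitioned into active states (where the payoff is `0`) and absorbing states (which
are trapping, with a payoff depending only on the state). -/
structure RecGame extends StocGame where
  absorbing : X → Prop
  g_active : ∀ x a b, ¬ absorbing x → g x a b = 0
  absorbing_q : ∀ x a b, absorbing x → q x a b x = 1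
  absorbing_g : ∀ x a b a' b', absorbing x → g x a b = g x a' b'

namespace RecGame

variable (G : RecGame)

/-- The stage payoff as a function of the state only: `0` on active states, and the
absorbing payoff on absorbing states. -/
def stateg (x : G.X) : ℝ :=
  G.g x (G.actA_nonempty x).choose (G.actB_nonempty x).choose

/-- Probability that the play is absorbed within the first `N` stages; since absorbing
states are trapping this is the probability that the state of stage `N` is absorbing,
i.e. `P(ρ ≤ N)` where `ρ` is the absorption time. -/
def absorbedProb (x₁ : G.X) (σ : G.toStocGame.Strategy1) (τ : G.toStocGame.Strategy2)
    (N : ℕ) : ℝ :=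
  ∑' hx : List (G.X × G.A × G.B) × G.X,
    if hx.1.length + 1 = N ∧ G.absorbing hx.2 then
      G.toStocGame.histProb x₁ σ τ hx.1 hx.2 else 0

/-- A uniformly terminating strategy of player 1. -/
def UniformlyTerminating1 (σ : G.toStocGame.Strategy1) : Prop :=
  ∀ ε > (0 : ℝ), ∃ N : ℕ, 1 ≤ N ∧ ∀ x₁, ¬ G.absorbing x₁ →
    ∀ τ, G.absorbedProb x₁ σ τ N ≥ 1 - ε

end RecGame

namespace StocGame

variable {G : StocGame}

lemma summable_q (x : G.X) (a : G.A) (b : G.B) (f : G.X → ℝ) :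
    Summable fun y => G.q x a b y * f y :=
  summable_of_hasFiniteSupport
    ((G.q_finsupp x a b).subset (Function.support_mul_subset_left _ _))

lemma q_tsum_mono (x : G.X) (a : G.A) (b : G.B) {f f' : G.X → ℝ} (h : ∀ y, f y ≤ f' y) :
    ∑' y, G.q x a b y * f y ≤ ∑' y, G.q x a b y * f' y :=
  (summable_q x a b f).tsum_le_tsum
    (fun y => mul_le_mul_of_nonneg_left (h y) (G.q_nonneg x a b y)) (summable_q x a b f')

lemma q_tsum_const (x : G.X) (a : G.A) (b : G.B) (c : ℝ) :
    ∑' y, G.q x a b y * c = c := by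
  rw [tsum_mul_right, G.q_sum, one_mul]

lemma q_tsum_add (x : G.X) (a : G.A) (b : G.B) (f f' : G.X → ℝ) :
    ∑' y, G.q x a b y * (f y + f' y) =
      ∑' y, G.q x a b y * f y + ∑' y, G.q x a b y * f' y := by
  simp only [mul_add]
  exact (summable_q x a b f).tsum_add (summable_q x a b f')

/-- The expectation of `u` under the mixed actions played after the history `(h, x)`. -/
def mixedAvg (σ : G.Strategy1) (τ : G.Strategy2) (h : List (G.X × G.A × G.B)) (x : G.X)
    (u : G.A → G.B → ℝ) : ℝ :=
  ∑ a ∈ G.actA x, ∑ b ∈ G.actB x, σ.play h x a * τ.play h x b * u a b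

lemma mixedAvg_const (σ : G.Strategy1) (τ : G.Strategy2) (h : List (G.X × G.A × G.B))
    (x : G.X) (c : ℝ) : mixedAvg σ τ h x (fun _ _ => c) = c := by
  simp only [mixedAvg, mul_assoc, ← Finset.mul_sum, ← Finset.sum_mul, σ.sum_one, τ.sum_one,
    one_mul]

lemma mixedAvg_add (σ : G.Strategy1) (τ : G.Strategy2) (h : List (G.X × G.A × G.B))
    (x : G.X) (u w : G.A → G.B → ℝ) :
    mixedAvg σ τ h x (fun a b => u a b + w a b) = mixedAvg σ τ h x u + mixedAvg σ τ h x w := by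
  simp only [mixedAvg, mul_add, Finset.sum_add_distrib]

lemma mixedAvg_mono (σ : G.Strategy1) (τ : G.Strategy2) (h : List (G.X × G.A × G.B))
    (x : G.X) {u w : G.A → G.B → ℝ} (huw : ∀ a b, u a b ≤ w a b) :
    mixedAvg σ τ h x u ≤ mixedAvg σ τ h x w :=
  Finset.sum_le_sum fun a _ => Finset.sum_le_sum fun b _ =>
    mul_le_mul_of_nonneg_left (huw a b) (mul_nonneg (σ.nonneg h x a) (τ.nonneg h x b))

lemma abs_mixedAvg_le (σ : G.Strategy1) (τ : G.Strategy2) (h : List (G.X × G.A × G.B))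
    (x : G.X) {u : G.A → G.B → ℝ} {c : ℝ} (hu : ∀ a b, |u a b| ≤ c) :
    |mixedAvg σ τ h x u| ≤ c := by
  rw [abs_le]
  constructor
  · rw [← mixedAvg_const σ τ h x (-c)]
    exact mixedAvg_mono σ τ h x fun a b => (abs_le.1 (hu a b)).1
  · rw [← mixedAvg_const σ τ h x c]
    exact mixedAvg_mono σ τ h x fun a b => (abs_le.1 (hu a b)).2

lemma le_mixedAvg (σ : G.Strategy1) (τ : G.Strategy2) (h : List (G.X × G.A × G.B))
    (x : G.X) {u : G.A → G.B → ℝ} {c : ℝ}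
    (hu : ∀ b ∈ G.actB x, c ≤ ∑ a ∈ G.actA x, σ.play h x a * u a b) :
    c ≤ mixedAvg σ τ h x u := by
  calc c = ∑ b ∈ G.actB x, τ.play h x b * c := by rw [← Finset.sum_mul, τ.sum_one, one_mul]
    _ ≤ ∑ b ∈ G.actB x, τ.play h x b * ∑ a ∈ G.actA x, σ.play h x a * u a b :=
        Finset.sum_le_sum fun b hb => mul_le_mul_of_nonneg_left (hu b hb) (τ.nonneg h x b)
    _ = mixedAvg σ τ h x u := by
        rw [mixedAvg, Finset.sum_comm]
        refine Finset.sum_congr rfl fun b _ => ?_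
        rw [Finset.mul_sum]
        exact Finset.sum_congr rfl fun a _ => by ring

/-- The expectation, after the history `(h, x)`, of `F` evaluated at the next history. -/
def nextAvg (σ : G.Strategy1) (τ : G.Strategy2) (F : List (G.X × G.A × G.B) → G.X → ℝ)
    (h : List (G.X × G.A × G.B)) (x : G.X) : ℝ :=
  mixedAvg σ τ h x fun a b => ∑' y, G.q x a b y * F (h ++ [(x, a, b)]) y

/-- The expectation of `F` evaluated at the history of length `t`. -/
def histAvg (x₁ : G.X) (σ : G.Strategy1) (τ : G.Strategy2) (t : ℕ)
    (F : List (G.X × G.A × G.B) → G.X → ℝ) : ℝ :=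
  ∑' hx : List (G.X × G.A × G.B) × G.X,
    if hx.1.length = t then G.histProb x₁ σ τ hx.1 hx.2 * F hx.1 hx.2 else 0

lemma histProb_nil (x₁ : G.X) (σ : G.Strategy1) (τ : G.Strategy2) (x : G.X) :
    G.histProb x₁ σ τ [] x = if x = x₁ then 1 else 0 := rfl

lemma histProb_concat (x₁ : G.X) (σ : G.Strategy1) (τ : G.Strategy2)
    (h : List (G.X × G.A × G.B)) (y : G.X) (a : G.A) (b : G.B) (x : G.X) :
    G.histProb x₁ σ τ (h ++ [(y, a, b)]) x =
      G.histProb x₁ σ τ h y * σ.play h y a * τ.play h y b * G.q y a b x := by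
  simp [histProb, histProbAux]

lemma histProb_nonneg (x₁ : G.X) (σ : G.Strategy1) (τ : G.Strategy2)
    (h : List (G.X × G.A × G.B)) : ∀ x, 0 ≤ G.histProb x₁ σ τ h x := by
  induction h using List.reverseRecOn with
  | nil => intro x; rw [histProb_nil]; split_ifs <;> simp
  | append_singleton h z ih =>
    obtain ⟨y, a, b⟩ := z
    intro x
    rw [histProb_concat]
    exact mul_nonneg (mul_nonneg (mul_nonneg (ih y) (σ.nonneg h y a)) (τ.nonneg h y b))
      (G.q_nonneg y a b x)

lemma finite_histories (x₁ : G.X) (σ : G.Strategy1) (τ : G.Strategy2) (t : ℕ) :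
    {hx : List (G.X × G.A × G.B) × G.X |
      hx.1.length = t ∧ G.histProb x₁ σ τ hx.1 hx.2 ≠ 0}.Finite := by
  induction t with
  | zero =>
    refine (Set.finite_singleton (([] : List (G.X × G.A × G.B)), x₁)).subset ?_
    rintro ⟨h, x⟩ ⟨hl, hp⟩
    obtain rfl := List.length_eq_zero_iff.1 hl
    simp only [histProb_nil, ne_eq, ite_eq_right_iff, one_ne_zero, imp_false, not_not] at hp
    simp [hp]
  | succ t ih =>
    refine (ih.biUnion fun hx _ => (G.actA hx.2).finite_toSet.biUnion fun a _ =>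
      (G.actB hx.2).finite_toSet.biUnion fun b _ =>
        (G.q_finsupp hx.2 a b).image fun y => (hx.1 ++ [(hx.2, a, b)], y)).subset ?_
    rintro ⟨h, y⟩ ⟨hl, hp⟩
    induction h using List.reverseRecOn with
    | nil => simp at hl
    | append_singleton h z _ =>
      obtain ⟨x, a, b⟩ := z
      simp only [histProb_concat] at hp
      have h4 := right_ne_zero_of_mul hp
      have h3 := right_ne_zero_of_mul (left_ne_zero_of_mul hp)
      have h2 := right_ne_zero_of_mul (left_ne_zero_of_mul (left_ne_zero_of_mul hp))
      have h1 := left_ne_zero_of_mul (left_ne_zero_of_mul (left_ne_zero_of_mul hp))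
      simp only [Set.mem_iUnion]
      refine ⟨(h, x), ⟨by simpa using hl, h1⟩, a, ?_, b, ?_, y, h4, rfl⟩
      · by_contra ha; exact h2 (σ.supp h x a ha)
      · by_contra hb; exact h3 (τ.supp h x b hb)

lemma finite_support_histAvg (x₁ : G.X) (σ : G.Strategy1) (τ : G.Strategy2) (t : ℕ)
    (F : List (G.X × G.A × G.B) → G.X → ℝ) :
    (Function.support fun hx : List (G.X × G.A × G.B) × G.X =>
      if hx.1.length = t then G.histProb x₁ σ τ hx.1 hx.2 * F hx.1 hx.2 else 0).Finite := by
  refine (finite_histories x₁ σ τ t).subset fun hx hne => ?_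
  rw [Function.mem_support] at hne
  split_ifs at hne with hl
  · exact ⟨hl, left_ne_zero_of_mul hne⟩
  · exact absurd rfl hne

lemma summable_histAvg (x₁ : G.X) (σ : G.Strategy1) (τ : G.Strategy2) (t : ℕ)
    (F : List (G.X × G.A × G.B) → G.X → ℝ) :
    Summable fun hx : List (G.X × G.A × G.B) × G.X =>
      if hx.1.length = t then G.histProb x₁ σ τ hx.1 hx.2 * F hx.1 hx.2 else 0 :=
  summable_of_hasFiniteSupport (finite_support_histAvg x₁ σ τ t F)

lemma histAvg_zero (x₁ : G.X) (σ : G.Strategy1) (τ : G.Strategy2)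
    (F : List (G.X × G.A × G.B) → G.X → ℝ) : histAvg x₁ σ τ 0 F = F [] x₁ := by
  rw [histAvg, tsum_eq_single (([] : List (G.X × G.A × G.B)), x₁)]
  · simp [histProb_nil]
  · rintro ⟨h, x⟩ hne
    split_ifs with hl
    · obtain rfl := List.length_eq_zero_iff.1 hl
      have : x ≠ x₁ := fun hx => hne (by rw [hx])
      simp [histProb_nil, this]
    · rfl

lemma histAvg_succ (x₁ : G.X) (σ : G.Strategy1) (τ : G.Strategy2) (t : ℕ)
    (F : List (G.X × G.A × G.B) → G.X → ℝ) :
    histAvg x₁ σ τ (t + 1) F = histAvg x₁ σ τ t (nextAvg σ τ F) := by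
  let e : (List (G.X × G.A × G.B) × G.X) × (G.A × G.B × G.X) →
      List (G.X × G.A × G.B) × G.X := fun p => (p.1.1 ++ [(p.1.2, p.2.1, p.2.2.1)], p.2.2.2)
  have he : Function.Injective e := by
    rintro ⟨⟨h, x⟩, a, b, y⟩ ⟨⟨h', x'⟩, a', b', y'⟩ heq
    simp only [e, Prod.mk.injEq] at heq
    obtain ⟨h1, h2⟩ := heq
    obtain ⟨h3, h4⟩ := List.append_inj' h1 rfl
    simp only [List.cons.injEq, Prod.mk.injEq, and_true] at h4
    simp [h2, h3, h4]
  have hsum := (summable_histAvg x₁ σ τ (t + 1) F).comp_injective he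
  rw [histAvg, ← he.tsum_eq, histAvg]
  · refine (Summable.tsum_prod hsum).trans ?_
    refine tsum_congr fun hx => ?_
    obtain ⟨h, x⟩ := hx
    simp only [e, Function.comp_apply, List.length_append, List.length_singleton,
      Nat.add_right_cancel_iff, histProb_concat]
    split_ifs with hl
    · have hs : Summable fun c : G.A × G.B × G.X =>
          G.histProb x₁ σ τ h x * σ.play h x c.1 * τ.play h x c.2.1 * G.q x c.1 c.2.1 c.2.2 *
            F (h ++ [(x, c.1, c.2.1)]) c.2.2 := by
        have := hsum.prod_factor (h, x)
        simpa [e, hl, histProb_concat] using this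
      rw [Summable.tsum_prod hs, nextAvg, mixedAvg, tsum_eq_sum (s := G.actA x), Finset.mul_sum]
      · refine Finset.sum_congr rfl fun a _ => ?_
        rw [Summable.tsum_prod (hs.prod_factor a), tsum_eq_sum (s := G.actB x), Finset.mul_sum]
        · refine Finset.sum_congr rfl fun b _ => ?_
          rw [← tsum_mul_left, ← tsum_mul_left]
          exact tsum_congr fun y => by ring
        · intro b hb
          simp [τ.supp h x b hb]
      · intro a ha
        simp [σ.supp h x a ha]
    · simp
  · rintro ⟨h, y⟩ hne
    rw [Function.mem_support] at hne
    split_ifs at hne with hl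
    · induction h using List.reverseRecOn with
      | nil => simp at hl
      | append_singleton h z _ =>
        obtain ⟨x, a, b⟩ := z
        exact ⟨((h, x), a, b, y), rfl⟩
    · exact absurd rfl hne

lemma histAvg_mono (x₁ : G.X) (σ : G.Strategy1) (τ : G.Strategy2) (t : ℕ)
    {F F' : List (G.X × G.A × G.B) → G.X → ℝ}
    (hF : ∀ h x, h.length = t → F h x ≤ F' h x) :
    histAvg x₁ σ τ t F ≤ histAvg x₁ σ τ t F' := by
  refine (summable_histAvg x₁ σ τ t F).tsum_le_tsum (fun hx => ?_)
    (summable_histAvg x₁ σ τ t F')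
  split_ifs with hl
  · exact mul_le_mul_of_nonneg_left (hF _ _ hl) (histProb_nonneg _ _ _ _ _)
  · exact le_rfl

lemma histAvg_add (x₁ : G.X) (σ : G.Strategy1) (τ : G.Strategy2) (t : ℕ)
    (F F' : List (G.X × G.A × G.B) → G.X → ℝ) :
    histAvg x₁ σ τ t (fun h x => F h x + F' h x) =
      histAvg x₁ σ τ t F + histAvg x₁ σ τ t F' := by
  rw [histAvg, histAvg, histAvg,
    ← (summable_histAvg x₁ σ τ t F).tsum_add (summable_histAvg x₁ σ τ t F')]
  refine tsum_congr fun hx => ?_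
  split_ifs <;> ring

lemma histAvg_const_mul (x₁ : G.X) (σ : G.Strategy1) (τ : G.Strategy2) (t : ℕ) (c : ℝ)
    (F : List (G.X × G.A × G.B) → G.X → ℝ) :
    histAvg x₁ σ τ t (fun h x => c * F h x) = c * histAvg x₁ σ τ t F := by
  rw [histAvg, histAvg, ← tsum_mul_left]
  refine tsum_congr fun hx => ?_
  split_ifs <;> ring

lemma histAvg_const (x₁ : G.X) (σ : G.Strategy1) (τ : G.Strategy2) (t : ℕ) (c : ℝ) :
    histAvg x₁ σ τ t (fun _ _ => c) = c := by
  induction t with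
  | zero => rw [histAvg_zero]
  | succ t ih =>
    have hc : nextAvg σ τ (fun _ _ => c) = fun _ _ => c := by
      funext h x
      simp only [nextAvg, q_tsum_const, mixedAvg_const]
    rw [histAvg_succ, hc, ih]

lemma stagePayoff_succ (x₁ : G.X) (σ : G.Strategy1) (τ : G.Strategy2) (t : ℕ) :
    G.stagePayoff x₁ σ τ (t + 1) =
      histAvg x₁ σ τ t (fun h x => mixedAvg σ τ h x (G.g x)) := by
  simp only [stagePayoff, histAvg, mixedAvg, Nat.add_right_cancel_iff]

lemma abs_stagePayoff_succ_le (x₁ : G.X) (σ : G.Strategy1) (τ : G.Strategy2) (t : ℕ) :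
    |G.stagePayoff x₁ σ τ (t + 1)| ≤ 1 := by
  have hg := fun h x => abs_le.1 (abs_mixedAvg_le σ τ h x (G.g_bdd x))
  rw [stagePayoff_succ, abs_le]
  constructor
  · rw [← histAvg_const x₁ σ τ t (-1)]
    exact histAvg_mono x₁ σ τ t fun h x _ => (hg h x).1
  · rw [← histAvg_const x₁ σ τ t 1]
    exact histAvg_mono x₁ σ τ t fun h x _ => (hg h x).2

/-- The expected total payoff of the next `n` stages after a history. -/
def totalPayoff (σ : G.Strategy1) (τ : G.Strategy2) :
    ℕ → List (G.X × G.A × G.B) → G.X → ℝ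
  | 0, _, _ => 0
  | n + 1, h, x => mixedAvg σ τ h x fun a b =>
      G.g x a b + ∑' y, G.q x a b y * totalPayoff σ τ n (h ++ [(x, a, b)]) y

lemma sum_stagePayoff (x₁ : G.X) (σ : G.Strategy1) (τ : G.Strategy2) (n t : ℕ) :
    ∑ s ∈ Finset.range n, G.stagePayoff x₁ σ τ (t + s + 1) =
      histAvg x₁ σ τ t (totalPayoff σ τ n) := by
  induction n generalizing t with
  | zero => exact (histAvg_const x₁ σ τ t 0).symm
  | succ n ih =>
    rw [Finset.sum_range_succ']
    have : ∀ s, t + (s + 1) + 1 = (t + 1) + s + 1 := fun s => by ring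
    simp only [this, ih, add_zero]
    rw [histAvg_succ, stagePayoff_succ, add_comm, ← histAvg_add]
    congr 1
    funext h x
    rw [nextAvg, ← mixedAvg_add, totalPayoff]

lemma natCast_mul_avgPayoff (x₁ : G.X) (σ : G.Strategy1) (τ : G.Strategy2) (n : ℕ) :
    (n : ℝ) * G.avgPayoff x₁ σ τ n = totalPayoff σ τ n [] x₁ := by
  have h1 : ∑ t ∈ Finset.Icc 1 n, G.stagePayoff x₁ σ τ t =
      ∑ s ∈ Finset.range n, G.stagePayoff x₁ σ τ (s + 1) := by
    rw [Finset.range_eq_Ico, Finset.sum_Ico_add' (G.stagePayoff x₁ σ τ) 0 n 1]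
    rfl
  have h2 := sum_stagePayoff x₁ σ τ n 0
  simp only [zero_add] at h2
  rw [histAvg_zero] at h2
  rw [avgPayoff, h1, h2]
  rcases Nat.eq_zero_or_pos n with rfl | hn
  · simp [totalPayoff]
  · rw [mul_inv_cancel_left₀]
    positivity

lemma abs_avgPayoff_le (x₁ : G.X) (σ : G.Strategy1) (τ : G.Strategy2) (n : ℕ) :
    |G.avgPayoff x₁ σ τ n| ≤ 1 := by
  rcases Nat.eq_zero_or_pos n with rfl | hn
  · simp [avgPayoff]
  have hn' : (0 : ℝ) < n := by exact_mod_cast hn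
  rw [avgPayoff, abs_mul, abs_of_nonneg (inv_nonneg.2 hn'.le), inv_mul_le_iff₀ hn', mul_one]
  calc |∑ t ∈ Finset.Icc 1 n, G.stagePayoff x₁ σ τ t|
      ≤ ∑ t ∈ Finset.Icc 1 n, |G.stagePayoff x₁ σ τ t| := Finset.abs_sum_le_sum_abs _ _
    _ ≤ ∑ t ∈ Finset.Icc 1 n, (1 : ℝ) := by
        refine Finset.sum_le_sum fun t ht => ?_
        obtain ⟨s, rfl⟩ := Nat.exists_eq_add_of_le' (Finset.mem_Icc.1 ht).1
        exact abs_stagePayoff_succ_le x₁ σ τ s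
    _ = n := by simp

/-- The pure strategy of player 1 selecting a fixed feasible action at each state. -/
instance : Nonempty G.Strategy1 :=
  ⟨{ play := fun _ x a => if a = (G.actA_nonempty x).choose then 1 else 0
     nonneg := fun _ _ _ => by split_ifs <;> simp
     supp := fun _ x a ha => if_neg <| by
       rintro rfl
       exact ha (G.actA_nonempty x).choose_spec
     sum_one := fun _ x => by simp [(G.actA_nonempty x).choose_spec] }⟩

/-- The pure strategy of player 2 selecting a fixed feasible action at each state. -/
instance : Nonempty G.Strategy2 :=
  ⟨{ play := fun _ x b => if b = (G.actB_nonempty x).choose then 1 else 0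
     nonneg := fun _ _ _ => by split_ifs <;> simp
     supp := fun _ x b hb => if_neg <| by
       rintro rfl
       exact hb (G.actB_nonempty x).choose_spec
     sum_one := fun _ x => by simp [(G.actB_nonempty x).choose_spec] }⟩

lemma bddBelow_avgPayoff (n : ℕ) (x : G.X) (σ : G.Strategy1) :
    BddBelow (Set.range fun τ => G.avgPayoff x σ τ n) :=
  ⟨-1, by rintro _ ⟨τ, rfl⟩; exact (abs_le.1 (abs_avgPayoff_le x σ τ n)).1⟩

lemma iInf_avgPayoff_le_one (n : ℕ) (x : G.X) (σ : G.Strategy1) :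
    ⨅ τ, G.avgPayoff x σ τ n ≤ 1 := by
  obtain ⟨τ⟩ := (inferInstance : Nonempty G.Strategy2)
  exact (ciInf_le (bddBelow_avgPayoff n x σ) τ).trans (abs_le.1 (abs_avgPayoff_le x σ τ n)).2

lemma bddAbove_iInf_avgPayoff (n : ℕ) (x : G.X) :
    BddAbove (Set.range fun σ => ⨅ τ, G.avgPayoff x σ τ n) :=
  ⟨1, by rintro _ ⟨σ, rfl⟩; exact iInf_avgPayoff_le_one n x σ⟩

lemma iInf_avgPayoff_le_nValue (n : ℕ) (x : G.X) (σ : G.Strategy1) :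
    ⨅ τ, G.avgPayoff x σ τ n ≤ G.nValue n x :=
  le_ciSup (bddAbove_iInf_avgPayoff n x) σ

lemma abs_nValue_le (n : ℕ) (x : G.X) : |G.nValue n x| ≤ 1 := by
  rw [abs_le]
  constructor
  · obtain ⟨σ⟩ := (inferInstance : Nonempty G.Strategy1)
    exact (le_ciInf fun τ => (abs_le.1 (abs_avgPayoff_le x σ τ n)).1).trans
      (iInf_avgPayoff_le_nValue n x σ)
  · exact ciSup_le fun σ => iInf_avgPayoff_le_one n x σ

/-- The strategy induced by `σ` after the first stage `z`. -/
def Strategy1.tail (σ : G.Strategy1) (z : G.X × G.A × G.B) : G.Strategy1 where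
  play h := σ.play (z :: h)
  nonneg h := σ.nonneg (z :: h)
  supp h := σ.supp (z :: h)
  sum_one h := σ.sum_one (z :: h)

/-- The first state of a finite history. -/
def firstState (h : List (G.X × G.A × G.B)) (x : G.X) : G.X :=
  (h.head?.map Prod.fst).getD x

lemma firstState_concat (h : List (G.X × G.A × G.B)) (x : G.X) (a : G.A) (b : G.B)
    (y : G.X) : firstState (h ++ [(x, a, b)]) y = firstState h x := by
  cases h <;> rfl

/-- Play the action `b` when feasible at the first stage, then the strategy `T a y`, where `a`
is the first action of player 1 and `y` the second state. -/
def Strategy2.cons (b : G.B) (T : G.A → G.X → G.Strategy2) : G.Strategy2 where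
  play
    | [], x, b' => if b' = (if b ∈ G.actB x then b else (G.actB_nonempty x).choose) then 1 else 0
    | (_, a, _) :: h, x, b' => (T a (firstState h x)).play h x b'
  nonneg
    | [], _, _ => by dsimp only; split_ifs <;> simp
    | _ :: h, x, b' => (T _ _).nonneg h x b'
  supp
    | [], x, b', hb => by
      refine if_neg ?_
      rintro rfl
      refine hb ?_
      split_ifs with h'
      exacts [h', (G.actB_nonempty x).choose_spec]
    | _ :: h, x, b', hb => (T _ _).supp h x b' hb
  sum_one
    | [], x => by
      rw [Finset.sum_ite_eq', if_pos]
      split_ifs with h'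
      exacts [h', (G.actB_nonempty x).choose_spec]
    | _ :: h, x => (T _ _).sum_one h x

lemma totalPayoff_tail (σ : G.Strategy1) (b : G.B) (T : G.A → G.X → G.Strategy2)
    (z : G.X × G.A × G.B) (y : G.X) (n : ℕ) (h : List (G.X × G.A × G.B)) (x : G.X)
    (hy : firstState h x = y) :
    totalPayoff σ (Strategy2.cons b T) n (z :: h) x =
      totalPayoff (σ.tail z) (T z.2.1 y) n h x := by
  induction n generalizing h x with
  | zero => rfl
  | succ n ih =>
    have hτ : (Strategy2.cons b T).play (z :: h) x = (T z.2.1 y).play h x := by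
      rw [← hy]; rfl
    rw [totalPayoff, totalPayoff, mixedAvg, mixedAvg, hτ]
    refine Finset.sum_congr rfl fun a _ => Finset.sum_congr rfl fun b' _ => ?_
    congr 2
    refine tsum_congr fun y' => ?_
    rw [← ih (h ++ [(x, a, b')]) y' (by rw [firstState_concat, hy])]
    rfl

/-- Half of the Shapley equation: player 1 has a mixed action which guarantees the value of the
`n + 1`-stage game, up to `η`, when the continuation payoffs are the `n`-stage values. -/
lemma exists_mixed_nValue_succ_le (n : ℕ) (x : G.X) {η : ℝ} (hη : 0 < η) :
    ∃ s : G.A → ℝ, (∀ a, 0 ≤ s a) ∧ (∀ a, a ∉ G.actA x → s a = 0) ∧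
      ∑ a ∈ G.actA x, s a = 1 ∧
      ∀ b ∈ G.actB x, ((n + 1 : ℕ) : ℝ) * G.nValue (n + 1) x - η ≤
        ∑ a ∈ G.actA x, s a * (G.g x a b + ∑' y, G.q x a b y * (n * G.nValue n y)) := by
  have hn : (0 : ℝ) < ((n + 1 : ℕ) : ℝ) := by positivity
  obtain ⟨σ, hσ⟩ := exists_lt_of_lt_ciSup
    (show G.nValue (n + 1) x - η / 2 / (n + 1 : ℕ) < ⨆ σ, ⨅ τ, G.avgPayoff x σ τ (n + 1) from
      sub_lt_self _ (by positivity))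
  refine ⟨σ.play [] x, σ.nonneg [] x, σ.supp [] x, σ.sum_one [] x, fun b hb => ?_⟩
  have hT : ∀ a y, ∃ τ : G.Strategy2,
      totalPayoff (σ.tail (x, a, b)) τ n [] y ≤ n * G.nValue n y + η / 2 := by
    intro a y
    obtain ⟨τ, hτ⟩ := exists_lt_of_ciInf_lt
      (show ⨅ τ, G.avgPayoff y (σ.tail (x, a, b)) τ n < G.nValue n y + η / 2 / (n + 1 : ℕ) from
        (iInf_avgPayoff_le_nValue n y _).trans_lt (lt_add_of_pos_right _ (by positivity)))
    refine ⟨τ, ?_⟩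
    rw [← natCast_mul_avgPayoff]
    have h1 := mul_le_mul_of_nonneg_left hτ.le (Nat.cast_nonneg (α := ℝ) n)
    have h2 : (n : ℝ) * (η / 2 / (n + 1 : ℕ)) ≤ η / 2 := by
      rw [mul_div_left_comm]
      refine mul_le_of_le_one_right (by positivity) ((div_le_one hn).2 ?_)
      push_cast; linarith
    linarith
  choose T hT using hT
  have h1 := hσ.le.trans (ciInf_le (bddBelow_avgPayoff (n + 1) x σ) (Strategy2.cons b T))
  have h2 := mul_le_mul_of_nonneg_left h1 hn.le
  rw [natCast_mul_avgPayoff, mul_sub, mul_div_cancel₀ _ hn.ne', totalPayoff, mixedAvg] at h2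
  have hplay : ∀ b', (Strategy2.cons b T).play [] x b' = if b' = b then 1 else 0 := by
    intro b'
    change (if b' = (if b ∈ G.actB x then b else _) then (1 : ℝ) else 0) = _
    rw [if_pos hb]
  have h3 : ∀ a ∈ G.actA x, (∑ b' ∈ G.actB x, σ.play [] x a * (Strategy2.cons b T).play [] x b' *
      (G.g x a b' + ∑' y, G.q x a b' y *
        totalPayoff σ (Strategy2.cons b T) n ([] ++ [(x, a, b')]) y)) ≤
      σ.play [] x a * (G.g x a b + ∑' y, G.q x a b y * (n * G.nValue n y)) +
        σ.play [] x a * (η / 2) := by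
    intro a _
    rw [Finset.sum_eq_single b (fun b' _ hne => by simp [hplay, hne]) (fun h => absurd hb h),
      hplay, if_pos rfl, mul_one, ← mul_add]
    refine mul_le_mul_of_nonneg_left ?_ (σ.nonneg [] x a)
    rw [add_assoc]
    refine add_le_add le_rfl ?_
    rw [← q_tsum_const x a b (η / 2), ← q_tsum_add]
    refine q_tsum_mono x a b fun y => ?_
    rw [List.nil_append, totalPayoff_tail σ b T (x, a, b) y n [] y rfl]
    exact hT a y
  have h4 := Finset.sum_le_sum h3
  rw [Finset.sum_add_distrib, ← Finset.sum_mul, σ.sum_one, one_mul] at h4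
  linarith

/-- A mixed action of player 1 at each stage and state, as a strategy. -/
def Strategy1.ofMarkov (s : ℕ → G.X → G.A → ℝ) (h0 : ∀ t x a, 0 ≤ s t x a)
    (hs : ∀ t x a, a ∉ G.actA x → s t x a = 0) (h1 : ∀ t x, ∑ a ∈ G.actA x, s t x a = 1) :
    G.Strategy1 where
  play h := s h.length
  nonneg h := h0 h.length
  supp h := hs h.length
  sum_one h := h1 h.length

end StocGame

namespace RecGame

open StocGame

variable {G : RecGame}

lemma tsum_q_of_absorbing {x : G.X} (hx : G.absorbing x) (a : G.A) (b : G.B) (f : G.X → ℝ) :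
    ∑' y, G.q x a b y * f y = f x := by
  have hq : ∀ y, y ≠ x → G.q x a b y = 0 := by
    intro y hy
    have hs : Summable (G.q x a b) := by
      simpa using summable_q (G := G.toStocGame) x a b fun _ => 1
    have h := hs.sum_le_tsum {x, y} fun z _ => G.q_nonneg x a b z
    rw [G.q_sum, Finset.sum_pair hy.symm, G.absorbing_q x a b hx] at h
    linarith [G.q_nonneg x a b y]
  rw [tsum_eq_single x fun y hy => by rw [hq y hy, zero_mul], G.absorbing_q x a b hx, one_mul]

lemma g_of_absorbing {x : G.X} (hx : G.absorbing x) (a : G.A) (b : G.B) :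
    G.g x a b = G.stateg x :=
  G.absorbing_g x _ _ _ _ hx

lemma abs_stateg_le (x : G.X) : |G.stateg x| ≤ 1 := G.g_bdd _ _ _

lemma mixedAvg_g_of_absorbing (σ : G.toStocGame.Strategy1) (τ : G.toStocGame.Strategy2)
    (h : List (G.X × G.A × G.B)) {x : G.X} (hx : G.absorbing x) :
    mixedAvg σ τ h x (G.g x) = G.stateg x := by
  have hg : G.g x = fun _ _ => G.stateg x := by
    funext a b; exact g_of_absorbing hx a b
  rw [hg, mixedAvg_const]

lemma mixedAvg_g_of_active (σ : G.toStocGame.Strategy1) (τ : G.toStocGame.Strategy2)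
    (h : List (G.X × G.A × G.B)) {x : G.X} (hx : ¬ G.absorbing x) :
    mixedAvg σ τ h x (G.g x) = 0 := by
  have hg : G.g x = fun _ _ => 0 := by
    funext a b; exact G.g_active x a b hx
  rw [hg, mixedAvg_const]

lemma totalPayoff_of_absorbing (σ : G.toStocGame.Strategy1) (τ : G.toStocGame.Strategy2)
    {x : G.X} (hx : G.absorbing x) (n : ℕ) (h : List (G.X × G.A × G.B)) :
    totalPayoff σ τ n h x = n * G.stateg x := by
  induction n generalizing h with
  | zero => simp [totalPayoff]
  | succ n ih =>
    rw [totalPayoff, mixedAvg_add, mixedAvg_g_of_absorbing σ τ h hx]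
    simp only [tsum_q_of_absorbing hx, ih]
    rw [mixedAvg_const]
    push_cast; ring

lemma nValue_of_absorbing {x : G.X} (hx : G.absorbing x) {n : ℕ} (hn : 1 ≤ n) :
    G.toStocGame.nValue n x = G.stateg x := by
  have havg : ∀ σ τ, G.toStocGame.avgPayoff x σ τ n = G.stateg x := by
    intro σ τ
    have h := natCast_mul_avgPayoff x σ τ n
    rw [totalPayoff_of_absorbing σ τ hx] at h
    exact mul_left_cancel₀ (by positivity) h
  simp only [nValue, havg, ciInf_const, ciSup_const]

/-- The probability that the state of stage `t + 1` is active. -/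
def activeProb (x₁ : G.X) (σ : G.toStocGame.Strategy1) (τ : G.toStocGame.Strategy2)
    (t : ℕ) : ℝ :=
  histAvg x₁ σ τ t fun _ x => if G.absorbing x then 0 else 1

lemma absorbedProb_succ (x₁ : G.X) (σ : G.toStocGame.Strategy1)
    (τ : G.toStocGame.Strategy2) (t : ℕ) :
    G.absorbedProb x₁ σ τ (t + 1) = 1 - activeProb x₁ σ τ t := by
  have h1 : G.absorbedProb x₁ σ τ (t + 1) =
      histAvg x₁ σ τ t fun _ x => if G.absorbing x then 1 else 0 := by
    rw [absorbedProb, histAvg]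
    refine tsum_congr fun hx => ?_
    simp only [Nat.add_right_cancel_iff]
    split_ifs <;> simp_all
  rw [h1, activeProb, eq_sub_iff_add_eq, ← histAvg_add]
  refine Eq.trans ?_ (histAvg_const x₁ σ τ t 1)
  congr 1
  funext h x
  split_ifs <;> simp

lemma activeProb_nonneg (x₁ : G.X) (σ : G.toStocGame.Strategy1)
    (τ : G.toStocGame.Strategy2) (t : ℕ) : 0 ≤ activeProb x₁ σ τ t := by
  rw [← histAvg_const x₁ σ τ t 0]
  exact histAvg_mono x₁ σ τ t fun h x _ => by split_ifs <;> simp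

lemma activeProb_succ_le (x₁ : G.X) (σ : G.toStocGame.Strategy1)
    (τ : G.toStocGame.Strategy2) (t : ℕ) :
    activeProb x₁ σ τ (t + 1) ≤ activeProb x₁ σ τ t := by
  rw [activeProb, histAvg_succ]
  refine histAvg_mono x₁ σ τ t fun h x _ => ?_
  split_ifs with hx
  · simp only [nextAvg, tsum_q_of_absorbing hx, if_pos hx]
    rw [mixedAvg_const]
  · refine (mixedAvg_mono σ τ h x fun a b => ?_).trans (mixedAvg_const σ τ h x 1).le
    refine (q_tsum_mono x a b fun y => ?_).trans (q_tsum_const x a b 1).le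
    beta_reduce
    split_ifs <;> simp

lemma activeProb_antitone (x₁ : G.X) (σ : G.toStocGame.Strategy1)
    (τ : G.toStocGame.Strategy2) : Antitone (activeProb x₁ σ τ) :=
  antitone_nat_of_succ_le (activeProb_succ_le x₁ σ τ)

section Potential

variable {σ : G.toStocGame.Strategy1} {s : ℕ → G.X → G.A → ℝ} {φ : ℕ → G.X → ℝ} {d κ : ℝ}

/-- Under a Markov strategy whose one-stage expectation of `φ` grows by `κ` at active states,
the expectation of `φ` grows by `κ` times the probability of being active. -/
lemma potential_le_histAvg (hσ : ∀ h x, σ.play h x = s h.length x)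
    (habs : ∀ t x, G.absorbing x → φ t x = G.stateg x + d)
    (hstep : ∀ t x, ¬ G.absorbing x → ∀ b ∈ G.actB x,
      φ t x + κ ≤ ∑ a ∈ G.actA x, s t x a * ∑' y, G.q x a b y * φ (t + 1) y)
    (hκ : 0 ≤ κ) (x₁ : G.X) (τ : G.toStocGame.Strategy2) (t : ℕ) :
    φ 0 x₁ + κ * (t * activeProb x₁ σ τ t) ≤ histAvg x₁ σ τ t fun _ x => φ t x := by
  induction t with
  | zero => rw [histAvg_zero]; simp
  | succ t ih =>
    have h1 : (histAvg x₁ σ τ t fun _ x => φ t x) + κ * activeProb x₁ σ τ t ≤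
        histAvg x₁ σ τ (t + 1) fun _ x => φ (t + 1) x := by
      rw [histAvg_succ, activeProb, ← histAvg_const_mul, ← histAvg_add]
      refine histAvg_mono x₁ σ τ t fun h x hl => ?_
      split_ifs with hx
      · simp only [nextAvg, tsum_q_of_absorbing hx, mixedAvg_const, habs _ x hx]
        simp
      · rw [mul_one, nextAvg]
        refine le_mixedAvg σ τ h x fun b hb => ?_
        rw [hσ, hl]
        exact hstep t x hx b hb
    have h2 : κ * ((t + 1 : ℕ) * activeProb x₁ σ τ (t + 1)) ≤
        κ * (t * activeProb x₁ σ τ t) + κ * activeProb x₁ σ τ t := by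
      rw [← mul_add]
      refine mul_le_mul_of_nonneg_left ?_ hκ
      push_cast
      nlinarith [activeProb_succ_le x₁ σ τ t, (Nat.cast_nonneg t : (0 : ℝ) ≤ t)]
    linarith

lemma mul_activeProb_le (hσ : ∀ h x, σ.play h x = s h.length x)
    (habs : ∀ t x, G.absorbing x → φ t x = G.stateg x + d)
    (hstep : ∀ t x, ¬ G.absorbing x → ∀ b ∈ G.actB x,
      φ t x + κ ≤ ∑ a ∈ G.actA x, s t x a * ∑' y, G.q x a b y * φ (t + 1) y)
    (hκ : 0 ≤ κ) (hφ : ∀ t x, |φ t x| ≤ 2) (x₁ : G.X) (τ : G.toStocGame.Strategy2) (t : ℕ) :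
    κ * (t * activeProb x₁ σ τ t) ≤ 4 := by
  have h1 := potential_le_histAvg hσ habs hstep hκ x₁ τ t
  have h2 : (histAvg x₁ σ τ t fun _ x => φ t x) ≤ 2 := by
    rw [← histAvg_const x₁ σ τ t 2]
    exact histAvg_mono x₁ σ τ t fun _ x _ => (abs_le.1 (hφ t x)).2
  linarith [(abs_le.1 (hφ 0 x₁)).1]

lemma le_stagePayoff_succ (hσ : ∀ h x, σ.play h x = s h.length x)
    (habs : ∀ t x, G.absorbing x → φ t x = G.stateg x + d)
    (hstep : ∀ t x, ¬ G.absorbing x → ∀ b ∈ G.actB x,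
      φ t x + κ ≤ ∑ a ∈ G.actA x, s t x a * ∑' y, G.q x a b y * φ (t + 1) y)
    (hκ : 0 ≤ κ) (hd : 0 ≤ d) (hφ : ∀ t x, |φ t x| ≤ 2)
    (x₁ : G.X) (τ : G.toStocGame.Strategy2) (t : ℕ) :
    φ 0 x₁ - d - 2 * activeProb x₁ σ τ t ≤ G.toStocGame.stagePayoff x₁ σ τ (t + 1) := by
  have h1 := potential_le_histAvg hσ habs hstep hκ x₁ τ t
  have h2 : (histAvg x₁ σ τ t fun _ x => φ t x) ≤
      G.toStocGame.stagePayoff x₁ σ τ (t + 1) + d + 2 * activeProb x₁ σ τ t := by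
    rw [stagePayoff_succ, activeProb, ← histAvg_const_mul]
    refine le_of_le_of_eq ?_ (congrArg (· + _) (congrArg (_ + ·) (histAvg_const x₁ σ τ t d)))
    rw [← histAvg_add, ← histAvg_add]
    refine histAvg_mono x₁ σ τ t fun h x _ => ?_
    split_ifs with hx
    · rw [habs t x hx, mixedAvg_g_of_absorbing σ τ h hx]; simp
    · rw [mixedAvg_g_of_active σ τ h hx]
      linarith [(abs_le.1 (hφ t x)).2]
  have h3 : 0 ≤ κ * (t * activeProb x₁ σ τ t) :=
    mul_nonneg hκ (mul_nonneg t.cast_nonneg (activeProb_nonneg x₁ σ τ t))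
  linarith

lemma exists_activeProb_le (hσ : ∀ h x, σ.play h x = s h.length x)
    (habs : ∀ t x, G.absorbing x → φ t x = G.stateg x + d)
    (hstep : ∀ t x, ¬ G.absorbing x → ∀ b ∈ G.actB x,
      φ t x + κ ≤ ∑ a ∈ G.actA x, s t x a * ∑' y, G.q x a b y * φ (t + 1) y)
    (hκ : 0 < κ) (hφ : ∀ t x, |φ t x| ≤ 2) {ε : ℝ} (hε : 0 < ε) :
    ∃ T : ℕ, ∀ t ≥ T, ∀ x₁ τ, activeProb x₁ σ τ t ≤ ε := by
  obtain ⟨T, hT⟩ := exists_nat_gt (4 / (κ * ε))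
  refine ⟨T, fun t ht x₁ τ => (activeProb_antitone x₁ σ τ ht).trans ?_⟩
  rw [div_lt_iff₀ (by positivity)] at hT
  by_contra! hlt
  have hTpos : (0 : ℝ) < T := by
    by_contra! h0
    nlinarith [mul_pos hκ hε]
  have h1 := mul_activeProb_le hσ habs hstep hκ.le hφ x₁ τ T
  have h2 : (T : ℝ) * κ * ε < T * κ * activeProb x₁ σ τ T :=
    mul_lt_mul_of_pos_left hlt (by positivity)
  linarith

lemma uniformlyTerminating_of_potential (hσ : ∀ h x, σ.play h x = s h.length x)
    (habs : ∀ t x, G.absorbing x → φ t x = G.stateg x + d)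
    (hstep : ∀ t x, ¬ G.absorbing x → ∀ b ∈ G.actB x,
      φ t x + κ ≤ ∑ a ∈ G.actA x, s t x a * ∑' y, G.q x a b y * φ (t + 1) y)
    (hκ : 0 < κ) (hφ : ∀ t x, |φ t x| ≤ 2) : G.UniformlyTerminating1 σ := by
  intro ε hε
  obtain ⟨T, hT⟩ := exists_activeProb_le hσ habs hstep hκ hφ hε
  refine ⟨T + 1, Nat.le_add_left 1 T, fun x₁ _ τ => ?_⟩
  rw [absorbedProb_succ]
  linarith [hT T le_rfl x₁ τ]

lemma exists_le_avgPayoff_of_potential (hσ : ∀ h x, σ.play h x = s h.length x)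
    (habs : ∀ t x, G.absorbing x → φ t x = G.stateg x + d)
    (hstep : ∀ t x, ¬ G.absorbing x → ∀ b ∈ G.actB x,
      φ t x + κ ≤ ∑ a ∈ G.actA x, s t x a * ∑' y, G.q x a b y * φ (t + 1) y)
    (hκ : 0 < κ) (hd : 0 ≤ d) (hφ : ∀ t x, |φ t x| ≤ 2) {ε : ℝ} (hε : 0 < ε) :
    ∃ N₀ : ℕ, 1 ≤ N₀ ∧ ∀ x₁, ∀ n ≥ N₀, ∀ τ,
      φ 0 x₁ - d - ε ≤ G.toStocGame.avgPayoff x₁ σ τ n := by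
  obtain ⟨T, hT⟩ := exists_activeProb_le hσ habs hstep hκ hφ (show 0 < ε / 4 by positivity)
  obtain ⟨N, hN⟩ := exists_nat_ge (6 * (T : ℝ) / ε)
  refine ⟨N + 1, Nat.le_add_left 1 N, fun x₁ n hn τ => ?_⟩
  have hn0 : (0 : ℝ) < n := by exact_mod_cast (Nat.succ_pos N).trans_le hn
  have hNn : 6 * (T : ℝ) ≤ n * ε := by
    rw [div_le_iff₀ hε] at hN
    have : (N : ℝ) ≤ n := by exact_mod_cast (Nat.le_succ N).trans hn
    nlinarith
  have hφ0 := (abs_le.1 (hφ 0 x₁)).2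
  have hstage : ∀ t, φ 0 x₁ - d - ε / 2 - (if t < T then 3 else 0) ≤
      G.toStocGame.stagePayoff x₁ σ τ (t + 1) := by
    intro t
    split_ifs with ht
    · linarith [(abs_le.1 (abs_stagePayoff_succ_le x₁ σ τ t)).1]
    · linarith [le_stagePayoff_succ hσ habs hstep hκ.le hd hφ x₁ τ t, hT t (not_lt.1 ht) x₁ τ]
  have hsum := Finset.sum_le_sum fun t (_ : t ∈ Finset.range n) => hstage t
  have hcard : ∑ t ∈ Finset.range n, (if t < T then (3 : ℝ) else 0) ≤ 3 * T := by
    rw [← Finset.sum_filter, Finset.sum_const, nsmul_eq_mul, mul_comm]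
    refine mul_le_mul_of_nonneg_left ?_ (by norm_num)
    have : (Finset.range n).filter (· < T) ⊆ Finset.range T := fun t ht =>
      Finset.mem_range.2 (Finset.mem_filter.1 ht).2
    simpa using Finset.card_le_card this
  have htotal := sum_stagePayoff x₁ σ τ n 0
  simp only [zero_add, histAvg_zero, ← natCast_mul_avgPayoff] at htotal
  rw [htotal, Finset.sum_sub_distrib, Finset.sum_const, Finset.card_range, nsmul_eq_mul] at hsum
  refine le_of_mul_le_mul_left ?_ hn0
  linarith

end Potential

end RecGame

namespace RecGame

open StocGame

variable {G : RecGame}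

/-- If `v_n` is close to `v_{n - m}` and both are bounded away from zero at active states, there
are a Markov strategy for player 1 and a potential for it starting at `v_n`, where `n = K * m`. -/
lemma exists_potential_of_close {K m : ℕ} (hK : 2 ≤ K) (hm : 1 ≤ m) {μ : ℝ} (hμ0 : 0 < μ)
    (hμ1 : μ ≤ 1)
    (hlow : ∀ x, ¬ G.absorbing x → μ / 2 ≤ G.toStocGame.nValue (K * m - m) x)
    (hclose : ∀ x, G.toStocGame.nValue (K * m - m) x ≤
      G.toStocGame.nValue (K * m) x + μ / (4 * K)) :
    ∃ (σ : G.toStocGame.Strategy1) (s : ℕ → G.X → G.A → ℝ) (φ : ℕ → G.X → ℝ) (κ : ℝ),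
      0 < κ ∧ (∀ h x, σ.play h x = s h.length x) ∧
      (∀ t x, G.absorbing x → φ t x = G.stateg x + 2 / K) ∧
      (∀ t x, ¬ G.absorbing x → ∀ b ∈ G.actB x,
        φ t x + κ ≤ ∑ a ∈ G.actA x, s t x a * ∑' y, G.q x a b y * φ (t + 1) y) ∧
      (∀ t x, |φ t x| ≤ 2) ∧
      ∀ x, ¬ G.absorbing x → φ 0 x = G.toStocGame.nValue (K * m) x := by
  have hm0 : (0 : ℝ) < m := by exact_mod_cast hm
  have hK0 : (2 : ℝ) ≤ K := by exact_mod_cast hK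
  obtain ⟨n, hn⟩ : ∃ n, n = K * m := ⟨_, rfl⟩
  obtain ⟨δ, hδ⟩ : ∃ δ : ℝ, δ = 1 / K := ⟨_, rfl⟩
  have hδ0 : 0 < δ := by rw [hδ]; positivity
  have hδ1 : δ ≤ 1 / 2 := by
    rw [hδ]; exact one_div_le_one_div_of_le (by norm_num) hK0
  have hmn : (m : ℝ) = δ * n := by
    rw [hδ, hn]; push_cast; field_simp
  have hn0 : (0 : ℝ) < n := by rw [hn]; push_cast; positivity
  have hmlt : m < n := by rw [hn]; nlinarith
  have h2K : (2 : ℝ) / K = 2 * δ := by rw [hδ]; ring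
  have h4K : μ / (4 * K) = μ * δ / 4 := by rw [hδ]; field_simp
  rw [← hn] at hlow hclose ⊢
  rw [h2K]
  rw [h4K] at hclose
  obtain ⟨c, hc⟩ : ∃ c : ℝ, c = μ * δ / (4 * m) := ⟨_, rfl⟩
  have hc0 : 0 < c := by rw [hc]; positivity
  have hmc : m * c = μ * δ / 4 := by rw [hc]; field_simp
  have hmcδ : m * c ≤ δ := by rw [hmc]; nlinarith
  have hjc : ∀ j : ℕ, j ≤ m → (j : ℝ) * c ≤ δ := fun j hj =>
    (mul_le_mul_of_nonneg_right (by exact_mod_cast hj) hc0.le).trans hmcδ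
  choose S hS0 hSs hS1 hS using fun (k : ℕ) (x : G.X) =>
    exists_mixed_nValue_succ_le (G := G.toStocGame) k x (show 0 < n * (c / 2) by positivity)
  let Φ : ℕ → G.X → ℝ := fun j x => if G.absorbing x then G.stateg x + 2 * δ else
    ((n - j : ℕ) : ℝ) / n * G.toStocGame.nValue (n - j) x + j * c
  have hreset : ∀ x, Φ m x ≤ Φ 0 x := by
    intro x
    simp only [Φ]
    split_ifs with hx
    · exact le_rfl
    · have h1 := hlow x hx
      have h2 := hclose x
      have h3 : ((n - m : ℕ) : ℝ) / n = 1 - δ := by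
        rw [Nat.cast_sub hmlt.le, hmn]; field_simp
      rw [h3, hmc, Nat.sub_zero, div_self hn0.ne', Nat.cast_zero, zero_mul, one_mul]
      nlinarith
  have hmod : ∀ t x, Φ (t % m + 1) x ≤ Φ ((t + 1) % m) x := by
    intro t x
    have hlt := Nat.mod_lt t hm
    rcases Nat.lt_or_ge (t % m + 1) m with h | h
    · rw [← Nat.mod_add_mod, Nat.mod_eq_of_lt h]
    · have h' : t % m + 1 = m := by omega
      have h0 : (t + 1) % m = 0 := by
        rw [← Nat.mod_add_mod, h', Nat.mod_self]
      rw [h', h0]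
      exact hreset x
  have hbound : ∀ j < m, ∀ x, |Φ j x| ≤ 2 := by
    intro j hj x
    have h1 := abs_le.1 (abs_stateg_le (G := G) x)
    have h2 := abs_nValue_le (G := G.toStocGame) (n - j) x
    have h3 := hjc j hj.le
    have h4 : 0 ≤ (j : ℝ) * c := by positivity
    have h5 : |((n - j : ℕ) : ℝ) / n * G.toStocGame.nValue (n - j) x| ≤ 1 := by
      rw [abs_mul]
      refine mul_le_one₀ ?_ (abs_nonneg _) h2
      rw [abs_of_nonneg (by positivity), div_le_one hn0]
      exact_mod_cast Nat.sub_le n j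
    have h6 := abs_le.1 h5
    simp only [Φ]
    split_ifs <;> rw [abs_le] <;> constructor <;> linarith
  have hΦstep : ∀ j < m, ∀ x, ¬ G.absorbing x → ∀ b ∈ G.actB x,
      Φ j x + c / 2 ≤ ∑ a ∈ G.actA x, S (n - j - 1) x a * ∑' y, G.q x a b y * Φ (j + 1) y := by
    intro j hj x hx b hb
    obtain ⟨k, hk⟩ : ∃ k, k = n - j - 1 := ⟨_, rfl⟩
    have hk1 : n - j = k + 1 := by omega
    have hk2 : n - (j + 1) = k := by omega
    have hkn : (k : ℝ) = n - (j + 1) := by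
      rw [← hk2, Nat.cast_sub (by omega)]; push_cast; rfl
    have hjm : (j : ℝ) + 1 ≤ m := by exact_mod_cast hj
    have hΦy : ∀ y, 1 / (n : ℝ) * (k * G.toStocGame.nValue k y) + (j + 1) * c ≤ Φ (j + 1) y := by
      intro y
      simp only [Φ, hk2]
      split_ifs with hy
      · rw [nValue_of_absorbing hy (by omega)]
        have h1 := hjc (j + 1) hj
        have h2 := (abs_le.1 (abs_stateg_le (G := G) y)).1
        have h3 : 1 / (n : ℝ) * (k * G.stateg y) = G.stateg y - (j + 1) / n * G.stateg y := by
          rw [hkn]; field_simp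
        have h4 : ((j : ℝ) + 1) / n ≤ δ := by
          rw [div_le_iff₀ hn0, ← hmn]; exact hjm
        have h5 : (0 : ℝ) ≤ ((j : ℝ) + 1) / n := by positivity
        have h6 : ((j : ℝ) + 1) / n * -G.stateg y ≤ δ :=
          (mul_le_of_le_one_right h5 (by linarith)).trans h4
        push_cast at h1
        linarith
      · push_cast; exact le_of_eq (by ring)
    have hSk := hS k x b hb
    have hsum : ∑ a ∈ G.actA x, S k x a *
        (G.g x a b + ∑' y, G.q x a b y * (k * G.toStocGame.nValue k y)) =
        ∑ a ∈ G.actA x, S k x a * ∑' y, G.q x a b y * (k * G.toStocGame.nValue k y) :=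
      Finset.sum_congr rfl fun a _ => by rw [G.g_active x a b hx, zero_add]
    rw [hsum] at hSk
    have hΦx : Φ j x = 1 / n * (((k + 1 : ℕ) : ℝ) * G.toStocGame.nValue (k + 1) x) + j * c := by
      simp only [Φ, if_neg hx, hk1]; ring
    calc Φ j x + c / 2
        = 1 / n * (((k + 1 : ℕ) : ℝ) * G.toStocGame.nValue (k + 1) x - n * (c / 2)) +
            (j + 1) * c := by
          rw [hΦx]; field_simp; ring
      _ ≤ 1 / n * (∑ a ∈ G.actA x, S k x a *
            ∑' y, G.q x a b y * (k * G.toStocGame.nValue k y)) + (j + 1) * c := by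
          gcongr
      _ = ∑ a ∈ G.actA x, S k x a *
            ∑' y, G.q x a b y * (1 / n * (k * G.toStocGame.nValue k y) + (j + 1) * c) := by
          simp only [q_tsum_add, q_tsum_const]
          simp only [mul_add (S k x _), Finset.sum_add_distrib, mul_left_comm _ (1 / (n : ℝ)),
            tsum_mul_left]
          rw [← Finset.sum_mul, hS1, one_mul, Finset.mul_sum]
      _ ≤ ∑ a ∈ G.actA x, S (n - j - 1) x a * ∑' y, G.q x a b y * Φ (j + 1) y := by
          rw [← hk]
          exact Finset.sum_le_sum fun a _ =>
            mul_le_mul_of_nonneg_left (q_tsum_mono x a b hΦy) (hS0 k x a)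
  refine ⟨Strategy1.ofMarkov (fun t => S (n - t % m - 1)) (fun t => hS0 _) (fun t => hSs _)
    (fun t => hS1 _), fun t => S (n - t % m - 1), fun t => Φ (t % m), c / 2, by positivity,
    fun _ _ => rfl, fun t x hx => if_pos hx, fun t x hx b hb => ?_,
    fun t x => hbound _ (Nat.mod_lt t hm) x, fun x hx => ?_⟩
  · exact (hΦstep _ (Nat.mod_lt t hm) x hx b hb).trans (Finset.sum_le_sum fun a _ =>
      mul_le_mul_of_nonneg_left (q_tsum_mono x a b (hmod t)) (hS0 _ x a))
  · simp only [Φ, if_neg hx, Nat.zero_mod, Nat.sub_zero, Nat.cast_zero, zero_mul, add_zero,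
      div_self hn0.ne', one_mul]

end RecGame

/-- If in a recursive game (countable state space) the `n`-stage
values `(v_n)` converge uniformly to a function `v` with `v ≥ M' > 0` on the active
states, then the game is positive-valued and player 1 uniformly guarantees `v` with
uniformly terminating strategies. -/
theorem recursive_game_positive_limit_guarantee
    (G : RecGame) (hcount : Countable G.X)
    (v : G.X → ℝ) (M' : ℝ) (hM' : 0 < M')
    (hconv : ∀ ε > (0 : ℝ), ∃ N : ℕ, ∀ n ≥ N, ∀ x, |G.toStocGame.nValue n x - v x| ≤ ε)
    (hpos : ∀ x, ¬ G.absorbing x → v x ≥ M') :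
    (∃ M > (0 : ℝ), ∃ n₀ : ℕ, 1 ≤ n₀ ∧ ∀ x, ¬ G.absorbing x →
      ∃ m : ℕ, 1 ≤ m ∧ m ≤ n₀ ∧ G.toStocGame.nValue m x ≥ M) ∧
    (∀ ε > (0 : ℝ), ∃ σ : G.toStocGame.Strategy1, G.UniformlyTerminating1 σ ∧
      ∃ N₀ : ℕ, 1 ≤ N₀ ∧ ∀ x₁, ¬ G.absorbing x₁ → ∀ n ≥ N₀,
        ∀ τ : G.toStocGame.Strategy2,
          G.toStocGame.avgPayoff x₁ σ τ n ≥ v x₁ - ε) := by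
  refine ⟨?_, fun ε hε => ?_⟩
  · obtain ⟨N, hN⟩ := hconv (M' / 2) (by positivity)
    refine ⟨M' / 2, by positivity, N + 1, Nat.le_add_left 1 N, fun x hx =>
      ⟨N + 1, Nat.le_add_left 1 N, le_rfl, ?_⟩⟩
    linarith [(abs_le.1 (hN (N + 1) (Nat.le_succ N) x)).1, hpos x hx]
  · obtain ⟨μ, hμ⟩ : ∃ μ, μ = min M' 1 := ⟨_, rfl⟩
    have hμ0 : 0 < μ := by rw [hμ]; exact lt_min hM' one_pos
    have hμ1 : μ ≤ 1 := by rw [hμ]; exact min_le_right _ _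
    have hμM : μ ≤ M' := by rw [hμ]; exact min_le_left _ _
    obtain ⟨K₀, hK₀⟩ := exists_nat_ge (8 / ε)
    obtain ⟨K, hKdef⟩ : ∃ K, K = K₀ + 2 := ⟨_, rfl⟩
    have hK : 2 ≤ K := by omega
    have hK2 : (2 : ℝ) ≤ K := by exact_mod_cast hK
    have hKε : 1 / (K : ℝ) ≤ ε / 8 := by
      rw [div_le_iff₀ hε] at hK₀
      rw [div_le_iff₀ (by positivity), hKdef]
      push_cast
      linarith
    have hμK : μ / (8 * K) ≤ 1 / K := by
      rw [div_le_div_iff₀ (by positivity) (by positivity)]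
      nlinarith
    have hμK' : μ / (8 * K) ≤ μ / 2 :=
      div_le_div_of_nonneg_left hμ0.le (by norm_num) (by linarith)
    have hμK2 : μ / (4 * K) = μ / (8 * K) + μ / (8 * K) := by field_simp; norm_num
    obtain ⟨N, hN⟩ := hconv (μ / (8 * K)) (by positivity)
    have hlarge : N + 1 ≤ K * (N + 1) - (N + 1) := by
      have : 2 * (N + 1) ≤ K * (N + 1) := Nat.mul_le_mul_right _ hK
      omega
    have h1 := fun x => abs_le.1 (hN (K * (N + 1) - (N + 1)) (by omega) x)
    have h2 := fun x => abs_le.1 (hN (K * (N + 1)) (by omega) x)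
    obtain ⟨σ, s, φ, κ, hκ, hσ, habs, hstep, hφ, hφ0⟩ :=
      RecGame.exists_potential_of_close (G := G) hK (Nat.le_add_left 1 N) hμ0 hμ1
        (fun x hx => by linarith [(h1 x).1, hpos x hx])
        (fun x => by linarith [(h1 x).2, (h2 x).1])
    refine ⟨σ, RecGame.uniformlyTerminating_of_potential hσ habs hstep hκ hφ, ?_⟩
    obtain ⟨N₀, hN₀, hguar⟩ := RecGame.exists_le_avgPayoff_of_potential hσ habs hstep hκ
      (by positivity) hφ (show 0 < ε / 4 by positivity)
    refine ⟨N₀, hN₀, fun x₁ hx₁ n hn τ => ?_⟩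
    have h3 := hguar x₁ n hn τ
    rw [hφ0 x₁ hx₁] at h3
    have h4 : (2 : ℝ) / K = 2 * (1 / K) := by ring
    linarith [(h2 x₁).1]
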